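/- Let Q ⊆ ℝ^d be a cube and R a closed touching cube of Q of the same side length (or R = Q), k ≥ 0 an integer, and P : L¹(Q) → 𝒫_{k−1} the averaged Taylor polynomial projection. Then for every f ∈ W^{k,p}(Q ∪ R) ∩ C^∞ on a neighborhood of Q ∪ R, every 0 ≤ ℓ ≤ k, every multi-index α with |α| ≤ ℓ, and every 1 ≤ p ≤ ∞, one has ‖∂^α(f − Pf)‖_{L^p(Q ∪ R)} ≤ C diam(Q)^{ℓ−|α|} ‖∇^ℓ f‖_{L^p(Q ∪ R)} with C depending only on d, k, p. -/

import Mathlib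

open Set Metric MeasureTheory ENNReal NNReal

noncomputable section

abbrev Euc (d : ℕ) := EuclideanSpace ℝ (Fin d)

/-- The closed axis-parallel cube with center `c` and half side length `r`. -/
def cube (d : ℕ) (c : Euc d) (r : ℝ) : Set (Euc d) :=
  {x : Euc d | ∀ i, |x i - c i| ≤ r}

/-- A closed axis-parallel (nondegenerate) cube in `ℝ^d`. -/
def IsClosedCube {d : ℕ} (Q : Set (Euc d)) : Prop :=
  ∃ (c : Euc d) (r : ℝ), 0 < r ∧ Q = cube d c r

/-- A dyadic cube: a cube of the mesh determined by the lattice `2^(-k) ℤ^d`. -/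
def IsDyadicCube {d : ℕ} (Q : Set (Euc d)) : Prop :=
  ∃ (k : ℤ) (m : Fin d → ℤ),
    Q = {x : Euc d | ∀ i, (m i : ℝ) * 2 ^ (-k) ≤ x i ∧ x i ≤ ((m i : ℝ) + 1) * 2 ^ (-k)}

/-- `f` is (the function of) a polynomial on `ℝ^d` of total degree at most `m`. -/
def MemPoly (d m : ℕ) (f : Euc d → ℝ) : Prop :=
  ∃ q : MvPolynomial (Fin d) ℝ, q.totalDegree ≤ m ∧
    ∀ x : Euc d, f x = MvPolynomial.eval (fun i => x i) q

/-- Comparison of `L^p` norms for comparable measures. -/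
lemma pap_eLpNorm_le_of_measure_le {α E : Type*} [MeasurableSpace α] [NormedAddCommGroup E]
    {μ ν : Measure α} {a : ℝ≥0∞} (ha : 1 ≤ a) (h : ν ≤ a • μ) (f : α → E)
    {p : ℝ≥0∞} (hp : 1 ≤ p) : eLpNorm f p ν ≤ a * eLpNorm f p μ := by
  refine (eLpNorm_mono_measure f h).trans ?_
  have ha0 : a ≠ 0 := (lt_of_lt_of_le one_pos ha).ne'
  rw [eLpNorm_smul_measure_of_ne_zero ha0, smul_eq_mul]
  gcongr
  calc a ^ (1 / p).toReal ≤ a ^ (1 : ℝ) := by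
        apply ENNReal.rpow_le_rpow_of_exponent_le ha
        have : (1 / p) ≤ 1 := by simpa using hp
        exact ENNReal.toReal_mono one_ne_top this
    _ = a := by simp

/-- Jensen / Minkowski on a product with a probability space. -/
lemma pap_jensen {α β E : Type*} [MeasurableSpace α] [MeasurableSpace β] [NormedAddCommGroup E]
    {μ : Measure α} [SFinite μ] {κ : Measure β} [IsProbabilityMeasure κ]
    {p : ℝ≥0∞} (hp : 1 ≤ p) (g : α → E) (G : α × β → ℝ≥0∞) (hG : Measurable G)
    (hg : ∀ᵐ x ∂μ, ‖g x‖ₑ ≤ ∫⁻ y, G (x, y) ∂κ) :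
    eLpNorm g p μ ≤ eLpNorm G p (μ.prod κ) := by
  have hp0 : p ≠ 0 := (lt_of_lt_of_le one_pos hp).ne'
  rcases eq_or_ne p ∞ with rfl | hpt
  · rw [eLpNorm_exponent_top, eLpNorm_exponent_top]
    have h1 : ∀ᵐ z ∂(μ.prod κ), G z ≤ eLpNormEssSup G (μ.prod κ) := by
      simpa using enorm_ae_le_eLpNormEssSup G (μ.prod κ)
    have h2 := Measure.ae_ae_of_ae_prod h1
    refine essSup_le_of_ae_le _ ?_
    filter_upwards [hg, h2] with x hx hx2
    refine hx.trans ((lintegral_mono_ae hx2).trans ?_)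
    simp
  · have hpr : 1 ≤ p.toReal := by
      rw [← ENNReal.toReal_one]; exact ENNReal.toReal_mono hpt hp
    rw [eLpNorm_eq_lintegral_rpow_enorm_toReal hp0 hpt,
      eLpNorm_eq_lintegral_rpow_enorm_toReal hp0 hpt]
    gcongr ?_ ^ _
    rw [lintegral_prod _ (by fun_prop)]
    refine lintegral_mono_ae ?_
    filter_upwards [hg] with x hx
    have hm : Measurable fun y => G (x, y) := hG.comp measurable_prodMk_left
    have := eLpNorm_le_eLpNorm_of_exponent_le hp (hm.aestronglyMeasurable (μ := κ))
    rw [eLpNorm_one_eq_lintegral_enorm, eLpNorm_eq_lintegral_rpow_enorm_toReal hp0 hpt] at this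
    simp only [enorm_eq_self] at this ⊢
    calc ‖g x‖ₑ ^ p.toReal ≤ ((∫⁻ y, G (x, y) ^ p.toReal ∂κ) ^ (1 / p.toReal)) ^ p.toReal := by
          gcongr; exact hx.trans this
      _ = _ := by
          rw [← ENNReal.rpow_mul, one_div, inv_mul_cancel₀ (by positivity), ENNReal.rpow_one]

/-- Measure of a preimage under a homothety. -/
lemma pap_homothety {d : ℕ} {K K' : Set (Euc d)} {z : Euc d} {θ : ℝ} (hθ : 0 < θ)
    (hK : MapsTo (AffineMap.homothety z θ) K K') (A : Set (Euc d)) :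
    volume ((AffineMap.homothety z θ) ⁻¹' A ∩ K) ≤ ENNReal.ofReal (θ⁻¹ ^ d) * volume (A ∩ K') := by
  have h1 : (AffineMap.homothety z θ) '' ((AffineMap.homothety z θ) ⁻¹' A ∩ K) ⊆ A ∩ K' := by
    rintro _ ⟨x, ⟨hx, hxK⟩, rfl⟩
    exact ⟨hx, hK hxK⟩
  have h2 := measure_mono (μ := (volume : Measure (Euc d))) h1
  rw [Measure.addHaar_image_homothety, finrank_euclideanSpace_fin, abs_of_pos (by positivity)] at h2
  calc volume ((AffineMap.homothety z θ) ⁻¹' A ∩ K)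
      = ENNReal.ofReal (θ⁻¹ ^ d) * (ENNReal.ofReal (θ ^ d) *
          volume ((AffineMap.homothety z θ) ⁻¹' A ∩ K)) := by
        rw [← mul_assoc, ← ENNReal.ofReal_mul (by positivity), ← mul_pow,
          inv_mul_cancel₀ hθ.ne', one_pow, ENNReal.ofReal_one, one_mul]
    _ ≤ _ := by gcongr

/-- `L^p` norm of a composition with a homothety. -/
lemma pap_eLpNorm_homothety {d : ℕ} {E : Type*} [NormedAddCommGroup E]
    {K K' : Set (Euc d)} {z : Euc d} {θ : ℝ} (hθ : 0 < θ) (hθ1 : θ ≤ 1)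
    (hK : MapsTo (AffineMap.homothety z θ) K K') {g : Euc d → E} (hg : StronglyMeasurable g)
    {p : ℝ≥0∞} (hp : 1 ≤ p) :
    eLpNorm (fun x => g (AffineMap.homothety z θ x)) p (volume.restrict K) ≤
      ENNReal.ofReal (θ⁻¹ ^ d) * eLpNorm g p (volume.restrict K') := by
  have hc : Continuous (AffineMap.homothety z θ : Euc d →ᵃ[ℝ] Euc d) :=
    AffineMap.homothety_continuous z θ
  have := eLpNorm_map_measure (μ := volume.restrict K) (f := AffineMap.homothety z θ)
    (g := g) (p := p) hg.aestronglyMeasurable hc.measurable.aemeasurable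
  change eLpNorm (g ∘ _) p _ ≤ _
  rw [← this]
  refine pap_eLpNorm_le_of_measure_le ?_ ?_ g hp
  · rw [ENNReal.one_le_ofReal]
    exact one_le_pow₀ ((one_le_inv₀ hθ).2 hθ1)
  · refine Measure.le_iff.2 fun A hA => ?_
    rw [Measure.map_apply hc.measurable hA, Measure.restrict_apply (hc.measurable hA),
      Measure.smul_apply, Measure.restrict_apply hA, smul_eq_mul]
    exact pap_homothety hθ hK A

/-- The pushforward of `ν ⊗ (ν ⊗ dt)` under `(x, y, t) ↦ x + t (y - x)`. -/
lemma pap_push {d : ℕ} {K : Set (Euc d)} (hK : Convex ℝ K) (hKm : MeasurableSet K)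
    (hK0 : volume K ≠ 0) (hKt : volume K ≠ ∞) (ν : Measure (Euc d))
    (hν : ν = (volume K)⁻¹ • volume.restrict K) :
    Measure.map (fun z : Euc d × (Euc d × ℝ) => AffineMap.lineMap z.1 z.2.1 z.2.2)
      (ν.prod (ν.prod (volume.restrict (Icc (0:ℝ) 1)))) ≤ ENNReal.ofReal (2 ^ d) • ν := by
  have : IsProbabilityMeasure ν := ⟨by
    rw [hν]; simp [ENNReal.inv_mul_cancel hK0 hKt]⟩
  have hνK : ∀ᵐ x ∂ν, x ∈ K := by
    rw [hν]
    exact Measure.ae_smul_measure (ae_restrict_mem hKm) _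
  have hΦ : Measurable (fun z : Euc d × (Euc d × ℝ) =>
      (AffineMap.lineMap z.1 z.2.1 z.2.2 : Euc d)) := by
    simp only [AffineMap.lineMap_apply_module']
    fun_prop
  -- single variable bound
  have key : ∀ (θ : ℝ), 1 / 2 ≤ θ → θ ≤ 1 → ∀ z ∈ K, ∀ A : Set (Euc d), MeasurableSet A →
      ν ((AffineMap.homothety z θ) ⁻¹' A) ≤ ENNReal.ofReal (2 ^ d) * ν A := by
    intro θ h1 h2 z hz A hA
    have hmaps : MapsTo (AffineMap.homothety z θ) K K := by
      intro x hx
      rw [AffineMap.homothety_eq_lineMap]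
      exact hK.lineMap_mem hz hx ⟨by linarith, h2⟩
    have hc : Continuous (AffineMap.homothety z θ : Euc d →ᵃ[ℝ] Euc d) :=
      AffineMap.homothety_continuous z θ
    have hh := pap_homothety (by linarith) hmaps A
    rw [hν, Measure.smul_apply, Measure.smul_apply, Measure.restrict_apply hA,
      Measure.restrict_apply (hc.measurable hA), smul_eq_mul, smul_eq_mul]
    calc (volume K)⁻¹ * volume ((AffineMap.homothety z θ) ⁻¹' A ∩ K)
        ≤ (volume K)⁻¹ * (ENNReal.ofReal (2 ^ d) * volume (A ∩ K)) := by
          gcongr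
          refine hh.trans ?_
          gcongr
          rw [inv_le_comm₀ (by linarith) (by norm_num)]
          linarith
      _ = _ := by ring
  refine Measure.le_iff.2 fun A hA => ?_
  rw [Measure.map_apply hΦ hA, Measure.smul_apply, smul_eq_mul]
  set S := (fun z : Euc d × (Euc d × ℝ) => (AffineMap.lineMap z.1 z.2.1 z.2.2 : Euc d)) ⁻¹' A
    with hS
  have hSm : MeasurableSet S := hΦ hA
  have hind : Measurable (S.indicator (fun _ => (1:ℝ≥0∞))) := measurable_const.indicator hSm
  rw [← lintegral_indicator_one hSm]
  change ∫⁻ z, S.indicator (fun _ => (1:ℝ≥0∞)) z ∂_ ≤ _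
  rw [lintegral_prod _ hind.aemeasurable]
  have e1 : ∀ x, ∫⁻ w, S.indicator (fun _ => (1:ℝ≥0∞)) (x, w) ∂(ν.prod (volume.restrict (Icc (0:ℝ) 1)))
      = ∫⁻ t in Icc (0:ℝ) 1, ∫⁻ y, S.indicator (fun _ => (1:ℝ≥0∞)) (x, y, t) ∂ν := by
    intro x
    exact lintegral_prod_symm' _ (hind.comp measurable_prodMk_left)
  simp_rw [e1]
  rw [lintegral_lintegral_swap]
  swap
  · apply Measurable.aemeasurable
    apply Measurable.lintegral_prod_right' (f := fun q : (Euc d × ℝ) × Euc d =>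
      S.indicator (fun _ => (1:ℝ≥0∞)) (q.1.1, q.2, q.1.2))
    exact hind.comp (by fun_prop)
  calc ∫⁻ t in Icc (0:ℝ) 1, ∫⁻ x, ∫⁻ y, S.indicator (fun _ => (1:ℝ≥0∞)) (x, y, t) ∂ν ∂ν
      ≤ ∫⁻ t in Icc (0:ℝ) 1, ENNReal.ofReal (2 ^ d) * ν A := by
        refine setLIntegral_mono measurable_const fun t ht => ?_
        rcases le_total t (1/2) with h | h
        · rw [lintegral_lintegral_swap]
          swap
          · exact (hind.comp (by fun_prop : Measurable fun q : Euc d × Euc d =>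
              (q.1, q.2, t))).aemeasurable
          calc ∫⁻ y, ∫⁻ x, S.indicator (fun _ => (1:ℝ≥0∞)) (x, y, t) ∂ν ∂ν
              ≤ ∫⁻ y, ENNReal.ofReal (2 ^ d) * ν A ∂ν := by
                refine lintegral_mono_ae ?_
                filter_upwards [hνK] with y hy
                refine le_trans (le_of_eq ?_) (key (1 - t) (by linarith) (by linarith [ht.1]) y hy A hA)
                have hc : Continuous (AffineMap.homothety y (1-t) : Euc d →ᵃ[ℝ] Euc d) :=
                  AffineMap.homothety_continuous y _
                rw [← lintegral_indicator_one (hc.measurable hA)]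
                refine lintegral_congr fun x => ?_
                have : (AffineMap.homothety y (1-t) x : Euc d) = AffineMap.lineMap x y t := by
                  rw [AffineMap.homothety_eq_lineMap, AffineMap.lineMap_apply_one_sub]
                have hiff : ((x, y, t) ∈ S) ↔ x ∈ (AffineMap.homothety y (1-t)) ⁻¹' A := by
                  rw [mem_preimage (s := A) (f := AffineMap.homothety y (1-t)), this]; rfl
                by_cases hx : (x, y, t) ∈ S
                · rw [indicator_of_mem hx, indicator_of_mem (hiff.1 hx), Pi.one_apply]
                · rw [indicator_of_notMem hx, indicator_of_notMem (fun h => hx (hiff.2 h))]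
            _ = _ := by simp
        · calc ∫⁻ x, ∫⁻ y, S.indicator (fun _ => (1:ℝ≥0∞)) (x, y, t) ∂ν ∂ν
              ≤ ∫⁻ y, ENNReal.ofReal (2 ^ d) * ν A ∂ν := by
                refine lintegral_mono_ae ?_
                filter_upwards [hνK] with y hy
                refine le_trans (le_of_eq ?_) (key t (by linarith) (by linarith [ht.2]) y hy A hA)
                have hc : Continuous (AffineMap.homothety y t : Euc d →ᵃ[ℝ] Euc d) :=
                  AffineMap.homothety_continuous y _
                rw [← lintegral_indicator_one (hc.measurable hA)]
                refine lintegral_congr fun x => ?_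
                have : (AffineMap.homothety y t x : Euc d) = AffineMap.lineMap y x t := by
                  rw [AffineMap.homothety_eq_lineMap]
                have hiff : ((y, x, t) ∈ S) ↔ x ∈ (AffineMap.homothety y t) ⁻¹' A := by
                  rw [mem_preimage (s := A) (f := AffineMap.homothety y t), this]; rfl
                by_cases hx : (y, x, t) ∈ S
                · rw [indicator_of_mem hx, indicator_of_mem (hiff.1 hx), Pi.one_apply]
                · rw [indicator_of_notMem hx, indicator_of_notMem (fun h => hx (hiff.2 h))]
            _ = _ := by simp
    _ = _ := by simp

/-- First order Poincaré inequality on a convex set for mean zero functions. -/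
lemma pap_poincare {d : ℕ} {E : Type*} [NormedAddCommGroup E] [NormedSpace ℝ E] [CompleteSpace E]
    {K U : Set (Euc d)} (hK : Convex ℝ K) (hKc : IsCompact K) (hK0 : volume K ≠ 0)
    (hU : IsOpen U) (hKU : K ⊆ U) {D : ℝ} (hD0 : 0 ≤ D) (hD : ∀ x ∈ K, ∀ y ∈ K, dist x y ≤ D)
    {h : Euc d → E} (hh : ContDiffOn ℝ 1 h U) (hmean : ∫ x in K, h x = 0)
    {p : ℝ≥0∞} (hp : 1 ≤ p) :
    eLpNorm h p (volume.restrict K) ≤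
      ENNReal.ofReal (2 ^ d * D) * eLpNorm (fun x => ‖fderiv ℝ h x‖) p (volume.restrict K) := by
  have hKm : MeasurableSet K := hKc.measurableSet
  have hKt : volume K ≠ ∞ := hKc.measure_lt_top.ne
  obtain ⟨ν, hν⟩ : ∃ ν : Measure (Euc d), ν = (volume K)⁻¹ • volume.restrict K := ⟨_, rfl⟩
  have hprob : IsProbabilityMeasure ν := ⟨by
    rw [hν]; simp [ENNReal.inv_mul_cancel hK0 hKt]⟩
  have hνK : ∀ᵐ x ∂ν, x ∈ K := by
    rw [hν]
    exact Measure.ae_smul_measure (ae_restrict_mem hKm) _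
  set κ := ν.prod (volume.restrict (Icc (0:ℝ) 1)) with hκ
  have hprob1 : IsProbabilityMeasure (volume.restrict (Icc (0:ℝ) 1)) := ⟨by simp⟩
  have hint : Integrable h ν := by
    rw [hν]
    exact ((hh.continuousOn.mono hKU).integrableOn_compact hKc).smul_measure
      (ENNReal.inv_ne_top.2 hK0)
  have hmeanν : ∫ x, h x ∂ν = 0 := by
    rw [hν, integral_smul_measure, hmean, smul_zero]
  set F : Euc d → ℝ≥0∞ := fun x => ‖fderiv ℝ h x‖ₑ with hF
  have hFm : Measurable F := (measurable_fderiv ℝ h).enorm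
  have hΦ : Measurable (fun z : Euc d × (Euc d × ℝ) =>
      (AffineMap.lineMap z.1 z.2.1 z.2.2 : Euc d)) := by
    simp only [AffineMap.lineMap_apply_module']
    fun_prop
  set G : Euc d × (Euc d × ℝ) → ℝ≥0∞ := fun z => F (AffineMap.lineMap z.1 z.2.1 z.2.2) with hG
  have hGm : Measurable G := hFm.comp hΦ
  -- segment estimate
  have seg : ∀ x ∈ K, ∀ y ∈ K, ‖h y - h x‖ₑ ≤
      ENNReal.ofReal D * ∫⁻ t in Icc (0:ℝ) 1, G (x, y, t) := by
    intro x hx y hy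
    have hmem : ∀ t ∈ Icc (0:ℝ) 1, (AffineMap.lineMap x y t : Euc d) ∈ U := fun t ht =>
      hKU (hK.lineMap_mem hx hy ht)
    have hcd : ContDiffOn ℝ 1 (fun t : ℝ => h (AffineMap.lineMap x y t)) (Icc 0 1) := by
      refine hh.comp (t := U) (f := fun t : ℝ => (AffineMap.lineMap x y t : Euc d)) ?_ hmem
      simp only [AffineMap.lineMap_apply_module']
      fun_prop
    have h1 := enorm_sub_le_lintegral_deriv_of_contDiffOn_Icc hcd zero_le_one
    simp only [AffineMap.lineMap_apply_one, AffineMap.lineMap_apply_zero] at h1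
    refine h1.trans ?_
    rw [← lintegral_const_mul _ (show Measurable (fun t : ℝ => G (x, y, t)) from
      hGm.comp (by fun_prop : Measurable fun t : ℝ => (x, y, t)))]
    refine setLIntegral_mono' measurableSet_Icc fun t ht => ?_
    have hd1 : HasDerivAt (fun t : ℝ => (AffineMap.lineMap x y t : Euc d)) (y - x) t :=
      AffineMap.hasDerivAt_lineMap
    have hd2 : HasFDerivAt h (fderiv ℝ h (AffineMap.lineMap x y t)) (AffineMap.lineMap x y t) :=
      ((hh.differentiableOn one_ne_zero).differentiableAt
        (hU.mem_nhds (hmem t ht))).hasFDerivAt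
    have hd3 := (hd2.comp_hasDerivAt t hd1).deriv
    change ‖deriv (h ∘ fun t : ℝ => (AffineMap.lineMap x y t : Euc d)) t‖ₑ ≤ _
    rw [hd3]
    refine (ContinuousLinearMap.le_opENorm _ _).trans ?_
    rw [mul_comm]
    refine mul_le_mul' ?_ le_rfl
    rw [← ofReal_norm, ← dist_eq_norm]
    exact ENNReal.ofReal_le_ofReal (hD y hy x hx)
  -- pointwise bound
  have pt : ∀ᵐ x ∂ν, ‖h x‖ₑ ≤ ∫⁻ w, ENNReal.ofReal D * G (x, w) ∂κ := by
    filter_upwards [hνK] with x hx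
    have e1 : h x = ∫ y, (h x - h y) ∂ν := by
      rw [integral_sub (integrable_const _) hint, hmeanν]; simp
    rw [e1]
    refine (enorm_integral_le_lintegral_enorm _).trans ?_
    rw [hκ, lintegral_prod _ (by
      exact (measurable_const.mul (hGm.comp measurable_prodMk_left)).aemeasurable)]
    refine lintegral_mono_ae ?_
    filter_upwards [hνK] with y hy
    rw [lintegral_const_mul _ (show Measurable (fun t : ℝ => G (x, y, t)) from
      hGm.comp (by fun_prop : Measurable fun t : ℝ => (x, y, t))),
      enorm_sub_rev]
    exact seg x hx y hy
  have main : eLpNorm h p ν ≤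
      ENNReal.ofReal (2 ^ d * D) * eLpNorm (fun x => ‖fderiv ℝ h x‖) p ν := by
    have j := pap_jensen hp h (fun z => ENNReal.ofReal D * G z) (measurable_const.mul hGm) pt
    refine j.trans ?_
    have hD' : (fun z => ENNReal.ofReal D * G z) = fun z => ‖D • ‖fderiv ℝ h (AffineMap.lineMap z.1 z.2.1 z.2.2 : Euc d)‖‖ₑ := by
      funext z
      rw [enorm_smul, enorm_norm]
      rw [Real.enorm_of_nonneg hD0]
    have j2 : eLpNorm (fun z => ENNReal.ofReal D * G z) p (ν.prod κ) =
        ENNReal.ofReal D * eLpNorm ((fun x => ‖fderiv ℝ h x‖) ∘ (fun z : Euc d × (Euc d × ℝ) =>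
          (AffineMap.lineMap z.1 z.2.1 z.2.2 : Euc d))) p (ν.prod κ) := by
      rw [hD', eLpNorm_enorm]
      change eLpNorm (D • ((fun x => ‖fderiv ℝ h x‖) ∘ (fun z : Euc d × (Euc d × ℝ) =>
          (AffineMap.lineMap z.1 z.2.1 z.2.2 : Euc d)))) p (ν.prod κ) = _
      rw [eLpNorm_const_smul]
      rw [Real.enorm_of_nonneg hD0]
    rw [j2, ← eLpNorm_map_measure
      ((measurable_fderiv ℝ h).norm.aestronglyMeasurable) hΦ.aemeasurable]
    have j3 := pap_eLpNorm_le_of_measure_le (by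
        rw [ENNReal.one_le_ofReal]; exact one_le_pow₀ (by norm_num))
      (pap_push hK hKm hK0 hKt ν hν) (fun x => ‖fderiv ℝ h x‖) hp
    calc _ ≤ ENNReal.ofReal D * (ENNReal.ofReal (2 ^ d) * eLpNorm (fun x => ‖fderiv ℝ h x‖) p ν) := by
          gcongr
      _ = _ := by
          rw [ENNReal.ofReal_mul (by positivity)]; ring
  -- undo the normalization
  have hinv0 : (volume K)⁻¹ ≠ 0 := ENNReal.inv_ne_zero.2 hKt
  have hinvt : (volume K)⁻¹ ≠ ∞ := ENNReal.inv_ne_top.2 hK0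
  rw [hν, eLpNorm_smul_measure_of_ne_zero hinv0, eLpNorm_smul_measure_of_ne_zero hinv0,
    smul_eq_mul, smul_eq_mul, mul_left_comm] at main
  refine (ENNReal.mul_le_mul_iff_right ?_ ?_).1 main
  · exact (ENNReal.rpow_pos (pos_iff_ne_zero.2 hinv0) hinvt).ne'
  · exact ENNReal.rpow_ne_top_of_nonneg ENNReal.toReal_nonneg hinvt

lemma pap_contDiffAt_iter {d : ℕ} {U : Set (Euc d)} (hU : IsOpen U) {f : Euc d → ℝ}
    (hf : ContDiffOn ℝ (⊤ : ℕ∞) f U) (m n : ℕ) {x : Euc d} (hx : x ∈ U) :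
    ContDiffAt ℝ m (iteratedFDeriv ℝ n f) x := by
  have := hf.contDiffAt (hU.mem_nhds hx)
  refine this.iteratedFDeriv_right ?_
  exact_mod_cast le_top

/-- Symmetry of iterated derivatives of smooth functions. -/
lemma pap_symm {d : ℕ} {U : Set (Euc d)} (hU : IsOpen U) {f : Euc d → ℝ}
    (hf : ContDiffOn ℝ (⊤ : ℕ∞) f U) (n : ℕ) :
    ∀ x ∈ U, ∀ (σ : Equiv.Perm (Fin n)) (v : Fin n → Euc d),
      iteratedFDeriv ℝ n f x (v ∘ σ) = iteratedFDeriv ℝ n f x v := by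
  -- derivative of an evaluated iterated derivative
  have hev : ∀ (n : ℕ) (u : Fin n → Euc d) (x : Euc d), x ∈ U → ∀ w,
      fderiv ℝ (fun y => iteratedFDeriv ℝ n f y u) x w = fderiv ℝ (iteratedFDeriv ℝ n f) x w u := by
    intro n u x hx w
    have h1 := ((pap_contDiffAt_iter hU hf 1 n hx).differentiableAt (by simp)).hasFDerivAt
    have h2 := ((ContinuousMultilinearMap.apply ℝ (fun _ : Fin n => Euc d) ℝ u).hasFDerivAt
      (x := iteratedFDeriv ℝ n f x)).comp x h1
    exact congrArg (fun T => T w) h2.fderiv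
  induction n with
  | zero =>
    intro x _ σ v
    rw [Subsingleton.elim (v ∘ σ) v]
  | succ n ih =>
    intro x hx σ
    have hσ : σ ∈ Submonoid.closure
        (Set.range fun i : Fin n => Equiv.swap i.castSucc i.succ) := by
      rw [Equiv.Perm.mclosure_swap_castSucc_succ]; trivial
    induction hσ using Submonoid.closure_induction with
    | one => intro v; rfl
    | mul a b _ _ ha hb =>
      intro v
      have : v ∘ ⇑(a * b) = (v ∘ a) ∘ b := rfl
      rw [this, hb, ha]
    | mem s hs =>
      obtain ⟨i, rfl⟩ := hs
      intro v
      cases n with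
      | zero => exact i.elim0
      | succ m =>
        rcases Fin.eq_zero_or_eq_succ i with rfl | ⟨i, rfl⟩
        · have hg : ContDiffAt ℝ 2 (iteratedFDeriv ℝ m f) x := pap_contDiffAt_iter hU hf 2 m hx
          have hsym := hg.isSymmSndFDerivAt (by simp)
          have expand : ∀ u : Fin (m + 1 + 1) → Euc d, iteratedFDeriv ℝ (m + 1 + 1) f x u =
              fderiv ℝ (fderiv ℝ (iteratedFDeriv ℝ m f)) x (u 0) (u 1) (Fin.tail (Fin.tail u)) := by
            intro u
            rw [iteratedFDeriv_succ_apply_left, ← hev (m+1) _ x hx]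
            have : (fun y => iteratedFDeriv ℝ (m+1) f y (Fin.tail u)) =
                fun y => fderiv ℝ (iteratedFDeriv ℝ m f) y (u 1) (Fin.tail (Fin.tail u)) := by
              funext y
              rw [iteratedFDeriv_succ_apply_left]
              rfl
            rw [this]
            have h1 : HasFDerivAt (fderiv ℝ (iteratedFDeriv ℝ m f))
                (fderiv ℝ (fderiv ℝ (iteratedFDeriv ℝ m f)) x) x :=
              ((hg.fderiv_right (m := 1) (by norm_num)).differentiableAt (by simp)).hasFDerivAt
            have h2 := (h1.clm_apply (hasFDerivAt_const (u 1) x))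
            have h3 := ((ContinuousMultilinearMap.apply ℝ (fun _ : Fin m => Euc d) ℝ
              (Fin.tail (Fin.tail u))).hasFDerivAt
              (x := fderiv ℝ (iteratedFDeriv ℝ m f) x (u 1))).comp x h2
            have h4 := congrArg (fun T => T (u 0)) h3.fderiv
            refine Eq.trans h4 ?_
            simp
          rw [expand, expand]
          have e0 : (v ∘ Equiv.swap (Fin.castSucc (0 : Fin (m+1))) (Fin.succ 0)) 0 = v 1 := by
            simp
          have e1 : (v ∘ Equiv.swap (Fin.castSucc (0 : Fin (m+1))) (Fin.succ 0)) 1 = v 0 := by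
            simp
          have e2 : Fin.tail (Fin.tail (v ∘ Equiv.swap (Fin.castSucc (0 : Fin (m+1))) (Fin.succ 0)))
              = Fin.tail (Fin.tail v) := by
            funext k
            simp only [Fin.tail, Function.comp]
            rw [Equiv.swap_apply_of_ne_of_ne]
            · simp
            · simp [Fin.ext_iff]
          rw [e0, e1, e2, hsym.eq]
        · rw [iteratedFDeriv_succ_apply_left, iteratedFDeriv_succ_apply_left]
          have e0 : (v ∘ Equiv.swap (Fin.castSucc (Fin.succ i)) (Fin.succ (Fin.succ i))) 0 = v 0 := by
            simp only [Function.comp]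
            rw [Equiv.swap_apply_of_ne_of_ne]
            · simp [Fin.ext_iff]
            · simp [Fin.ext_iff]
          have e1 : Fin.tail (v ∘ Equiv.swap (Fin.castSucc (Fin.succ i)) (Fin.succ (Fin.succ i))) =
              Fin.tail v ∘ Equiv.swap (Fin.castSucc i) (Fin.succ i) := by
            funext k
            simp only [Fin.tail, Function.comp]
            rw [← Fin.succ_castSucc]
            congr 1
            exact ((Fin.succ_injective _).map_swap _ _ k).symm
          rw [e0, e1, ← hev _ _ x hx, ← hev _ _ x hx]
          have : (fun y => iteratedFDeriv ℝ (m+1) f y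
              (Fin.tail v ∘ Equiv.swap (Fin.castSucc i) (Fin.succ i))) =ᶠ[nhds x]
              (fun y => iteratedFDeriv ℝ (m+1) f y (Fin.tail v)) := by
            filter_upwards [hU.mem_nhds hx] with y hy
            exact ih y hy _ _
          rw [this.fderiv_eq]

lemma pap_memPoly_contDiff {d m : ℕ} {q : Euc d → ℝ} (hq : MemPoly d m q) :
    ContDiff ℝ (⊤ : ℕ∞) q := by
  obtain ⟨Q, -, hQ⟩ := hq
  have : q = fun x => ∑ s ∈ Q.support, Q.coeff s * ∏ i, (x i) ^ s i := by
    funext x; rw [hQ, MvPolynomial.eval_eq']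
  rw [this]
  refine ContDiff.sum fun s _ => contDiff_const.mul (contDiff_prod fun i _ => ?_)
  exact ContDiff.pow (by fun_prop) _

lemma pap_memPoly_diag {d m : ℕ} (A : ContinuousMultilinearMap ℝ (fun _ : Fin m => Euc d) ℝ)
    (a : ℝ) : MemPoly d m (fun x => a * A (fun _ => x)) := by
  refine ⟨∑ s : Fin m → Fin d, MvPolynomial.C (a * A (fun i => EuclideanSpace.single (s i) 1)) *
    ∏ i, MvPolynomial.X (s i), ?_, ?_⟩
  · refine MvPolynomial.totalDegree_finsetSum_le fun s _ => ?_
    refine (MvPolynomial.totalDegree_mul _ _).trans ?_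
    rw [MvPolynomial.totalDegree_C, zero_add]
    refine (MvPolynomial.totalDegree_finsetProd _ _).trans ?_
    simp
  · intro x
    have hx : x = ∑ j, x j • EuclideanSpace.single j (1:ℝ) := by
      ext k; simp [Finset.sum_apply, Pi.single_apply]
    have : A (fun _ => x) = ∑ s : Fin m → Fin d, (∏ i, x (s i)) *
        A (fun i => EuclideanSpace.single (s i) 1) := by
      conv_lhs => rw [hx]
      rw [A.map_sum]
      refine Finset.sum_congr rfl fun s _ => ?_
      rw [A.map_smul_univ, smul_eq_mul]
    change a * A (fun _ => x) = _
    rw [this, Finset.mul_sum, map_sum]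
    refine Finset.sum_congr rfl fun s _ => ?_
    simp [MvPolynomial.eval_prod]
    ring

lemma pap_memPoly_mono {d m n : ℕ} (h : m ≤ n) {q : Euc d → ℝ} (hq : MemPoly d m q) :
    MemPoly d n q := by
  obtain ⟨Q, h1, h2⟩ := hq
  exact ⟨Q, h1.trans h, h2⟩

lemma pap_memPoly_add {d m : ℕ} {q q' : Euc d → ℝ} (hq : MemPoly d m q) (hq' : MemPoly d m q') :
    MemPoly d m (q + q') := by
  obtain ⟨Q, h1, h2⟩ := hq
  obtain ⟨Q', h1', h2'⟩ := hq'
  exact ⟨Q + Q', (MvPolynomial.totalDegree_add _ _).trans (max_le h1 h1'),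
    fun x => by simp [h2, h2']⟩

lemma pap_iter_zero_of_ge {d m : ℕ} {q : Euc d → ℝ}
    (h : ∀ x, iteratedFDeriv ℝ m q x = 0) : ∀ i, m ≤ i → ∀ x, iteratedFDeriv ℝ i q x = 0 := by
  intro i hi
  induction i, hi using Nat.le_induction with
  | base => exact h
  | succ i hi ih =>
    intro x
    have : iteratedFDeriv ℝ i q = fun _ => 0 := funext ih
    rw [← norm_eq_zero, ← norm_fderiv_iteratedFDeriv, this, fderiv_fun_const]
    exact norm_zero (E := Euc d →L[ℝ] (ContinuousMultilinearMap ℝ (fun _ : Fin i => Euc d) ℝ))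

/-- Existence of the polynomial adapted to the averages of the derivatives. -/
lemma pap_exists_poly {d : ℕ} {K U : Set (Euc d)} (hKc : IsCompact K) (hK0 : volume K ≠ 0)
    (hU : IsOpen U) (hKU : K ⊆ U) (m : ℕ) :
    ∀ f : Euc d → ℝ, ContDiffOn ℝ (⊤ : ℕ∞) f U →
    ∃ q : Euc d → ℝ, MemPoly d (m - 1) q ∧ (∀ i, m ≤ i → ∀ x, iteratedFDeriv ℝ i q x = 0) ∧
      ∀ i < m, ∫ x in K, iteratedFDeriv ℝ i (f - q) x = 0 := by
  induction m with
  | zero =>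
    intro f _
    refine ⟨0, ⟨0, by simp, by simp⟩, ?_, by simp⟩
    intro i _ x
    simp
  | succ m ih =>
    intro f hf
    have hKm : MeasurableSet K := hKc.measurableSet
    have hKt : volume K ≠ ∞ := hKc.measure_lt_top.ne
    have hKr : (volume.real K) ≠ 0 := by
      rw [Measure.real]; exact ENNReal.toReal_ne_zero.2 ⟨hK0, hKt⟩
    set A : ContinuousMultilinearMap ℝ (fun _ : Fin m => Euc d) ℝ :=
      (volume.real K)⁻¹ • ∫ x in K, iteratedFDeriv ℝ m f x with hA
    have hcont : ContinuousOn (iteratedFDeriv ℝ m f) K := fun x hx =>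
      (pap_contDiffAt_iter hU hf 0 m (hKU hx)).continuousAt.continuousWithinAt
    have hint : IntegrableOn (iteratedFDeriv ℝ m f) K := hcont.integrableOn_compact hKc
    have hAv : ∀ v, A v = (volume.real K)⁻¹ * ∫ x in K, iteratedFDeriv ℝ m f x v := by
      intro v
      have := (ContinuousMultilinearMap.apply ℝ (fun _ : Fin m => Euc d) ℝ v).integral_comp_comm hint
      simp only [ContinuousMultilinearMap.apply_apply] at this
      rw [this, hA]
      rfl
    have hAs : ∀ (σ : Equiv.Perm (Fin m)) v, A (v ∘ σ) = A v := by
      intro σ v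
      rw [hAv, hAv]
      congr 1
      exact setIntegral_congr_fun hKm fun x hx => pap_symm hU hf m x (hKU hx) σ v
    set q₁ : Euc d → ℝ := fun x => ((m.factorial : ℝ)⁻¹) * A (fun _ => x) with hq₁
    have hq₁P : MemPoly d m q₁ := pap_memPoly_diag A _
    have hq₁c := pap_memPoly_contDiff hq₁P
    have hq₁D : ∀ x, iteratedFDeriv ℝ m q₁ x = A := by
      intro x
      have e : q₁ = (m.factorial : ℝ)⁻¹ • (fun x => A (fun _ => x)) := rfl
      have hAc : ContDiff ℝ (⊤ : ℕ∞) (fun x => A (fun _ => x)) := by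
        have := pap_memPoly_contDiff (pap_memPoly_diag A 1)
        simpa using this
      rw [e, iteratedFDeriv_const_smul_apply ((hAc.of_le (by exact_mod_cast le_top)).contDiffAt)]
      ext v
      rw [smul_apply, ContinuousMultilinearMap.iteratedFDeriv_comp_diagonal]
      have : ∀ σ : Equiv.Perm (Fin m), A (fun i => v (σ i)) = A v := fun σ => hAs σ v
      simp only [this, Finset.sum_const, Finset.card_univ, Fintype.card_perm, Fintype.card_fin,
        smul_eq_mul, nsmul_eq_mul]
      rw [← mul_assoc, inv_mul_cancel₀ (by exact_mod_cast m.factorial_ne_zero), one_mul]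
    have hq₁z : ∀ i, m + 1 ≤ i → ∀ x, iteratedFDeriv ℝ i q₁ x = 0 := by
      apply pap_iter_zero_of_ge
      intro x
      have : iteratedFDeriv ℝ m q₁ = fun _ => A := funext hq₁D
      rw [← norm_eq_zero, ← norm_fderiv_iteratedFDeriv, this, fderiv_fun_const]
      exact norm_zero (E := Euc d →L[ℝ] (ContinuousMultilinearMap ℝ (fun _ : Fin m => Euc d) ℝ))
    have hf₁ : ContDiffOn ℝ (⊤ : ℕ∞) (f - q₁) U := hf.sub hq₁c.contDiffOn
    obtain ⟨q₂, hq₂P, hq₂z, hq₂m⟩ := ih (f - q₁) hf₁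
    have hq₂c := pap_memPoly_contDiff hq₂P
    refine ⟨q₁ + q₂, pap_memPoly_add hq₁P (pap_memPoly_mono (by omega) hq₂P), ?_, ?_⟩
    · intro i hi x
      rw [iteratedFDeriv_add_apply ((hq₁c.of_le (by exact_mod_cast le_top)).contDiffAt)
        ((hq₂c.of_le (by exact_mod_cast le_top)).contDiffAt), hq₁z i hi, hq₂z i (by omega), add_zero]
    · intro i hi
      have e : f - (q₁ + q₂) = f - q₁ - q₂ := by rw [sub_sub]
      rw [e]
      rcases Nat.lt_succ_iff_lt_or_eq.1 hi with h | rfl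
      · exact hq₂m i h
      · have : ∫ x in K, iteratedFDeriv ℝ i (f - q₁ - q₂) x =
            ∫ x in K, (iteratedFDeriv ℝ i f x - A) := by
          refine setIntegral_congr_fun hKm fun x hx => ?_
          have c1 : ContDiffAt ℝ i f x :=
            (hf.contDiffAt (hU.mem_nhds (hKU hx))).of_le (by exact_mod_cast le_top)
          have c2 : ContDiffAt ℝ i q₁ x := (hq₁c.of_le (by exact_mod_cast le_top)).contDiffAt
          have c3 : ContDiffAt ℝ i q₂ x := (hq₂c.of_le (by exact_mod_cast le_top)).contDiffAt
          change iteratedFDeriv ℝ i (f - q₁ - q₂) x = iteratedFDeriv ℝ i f x - A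
          rw [iteratedFDeriv_sub_apply (show ContDiffAt ℝ i (f - q₁) x from c1.sub c2) c3, iteratedFDeriv_sub_apply c1 c2, hq₁D,
            hq₂z i le_rfl, sub_zero]
        rw [this, integral_sub hint (integrableOn_const hKt), setIntegral_const, hA,
          smul_smul, mul_inv_cancel₀ hKr, one_smul, sub_self]

/-- Iterated Poincaré inequality. -/
lemma pap_poincare_iter {d : ℕ} {K U : Set (Euc d)} (hK : Convex ℝ K) (hKc : IsCompact K)
    (hK0 : volume K ≠ 0) (hU : IsOpen U) (hKU : K ⊆ U) {D : ℝ} (hD0 : 0 ≤ D)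
    (hD : ∀ x ∈ K, ∀ y ∈ K, dist x y ≤ D) {g : Euc d → ℝ} (hg : ContDiffOn ℝ (⊤ : ℕ∞) g U)
    {l : ℕ} (hmean : ∀ i < l, ∫ x in K, iteratedFDeriv ℝ i g x = 0) {p : ℝ≥0∞} (hp : 1 ≤ p)
    (n : ℕ) : ∀ j, j + n = l →
    eLpNorm (fun x => ‖iteratedFDeriv ℝ j g x‖) p (volume.restrict K) ≤
      ENNReal.ofReal ((2 ^ d * D) ^ n) *
        eLpNorm (fun x => ‖iteratedFDeriv ℝ l g x‖) p (volume.restrict K) := by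
  induction n with
  | zero =>
    intro j hj
    obtain rfl : j = l := by omega
    simp
  | succ n ih =>
    intro j hj
    have h1 := pap_poincare hK hKc hK0 hU hKU hD0 hD (h := iteratedFDeriv ℝ j g)
      (fun x hx => (pap_contDiffAt_iter hU hg 1 j hx).contDiffWithinAt) (hmean j (by omega)) hp
    have h2 := ih (j + 1) (by omega)
    simp only [norm_fderiv_iteratedFDeriv] at h1
    rw [eLpNorm_norm]
    refine h1.trans ?_
    have h0 : (0 : ℝ) ≤ 2 ^ d * D := by positivity
    rw [pow_succ', ENNReal.ofReal_mul h0, mul_assoc]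
    exact mul_le_mul_right h2 _

/-- Extrapolation of polynomials along rays. -/
lemma pap_extrapolate {d N : ℕ} {g : Euc d → ℝ} (hg : MemPoly d N g) (θ : Fin (N + 1) → ℝ)
    (hθ : Function.Injective θ) (c x : Euc d) :
    g x = ∑ m, (Lagrange.basis Finset.univ θ m).eval 1 * g (AffineMap.homothety c (θ m) x) := by
  obtain ⟨Q, hQ, hgQ⟩ := hg
  set w : Fin d → Polynomial ℝ := fun i => Polynomial.C (c i) + Polynomial.C (x i - c i) * Polynomial.X
    with hw
  set R : Polynomial ℝ := MvPolynomial.aeval w Q with hR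
  have hRe : ∀ t, R.eval t = g (AffineMap.homothety c t x) := by
    intro t
    rw [hgQ, hR, ← Polynomial.coe_evalRingHom, MvPolynomial.aeval_def, MvPolynomial.hom_eval₂,
      ← MvPolynomial.eval₂_id]
    congr 1
    · ext y; simp
    · funext i
      simp [hw, AffineMap.homothety_apply]
      ring
  have hdeg : R.natDegree ≤ N := by
    have := MvPolynomial.aeval_natDegree_le Q hQ w (n := 1) (fun i => by
      change (Polynomial.C (c i) + Polynomial.C (x i - c i) * Polynomial.X).natDegree ≤ 1
      rw [add_comm]
      exact Polynomial.natDegree_linear_le)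
    simpa using this
  have h := Lagrange.eq_interpolate (s := Finset.univ) (v := θ) (f := R) (fun a _ b _ h => hθ h) (by
    refine (Polynomial.degree_le_of_natDegree_le hdeg).trans_lt ?_
    simp only [Finset.card_univ, Fintype.card_fin]
    exact_mod_cast Nat.lt_succ_self N)
  have h1 := congrArg (Polynomial.eval 1) h
  rw [hRe, Lagrange.interpolate_apply, Polynomial.eval_finsetSum] at h1
  simp only [AffineMap.homothety_one] at h1
  refine h1.trans (Finset.sum_congr rfl fun m _ => ?_)
  rw [Polynomial.eval_mul, Polynomial.eval_C, hRe, mul_comm]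

lemma pap_iter_homothety {d : ℕ} {g : Euc d → ℝ} (hg : ContDiff ℝ (⊤ : ℕ∞) g) (c : Euc d)
    (t : ℝ) (j : ℕ) (x : Euc d) :
    iteratedFDeriv ℝ j (fun y => g (AffineMap.homothety c t y)) x =
      t ^ j • iteratedFDeriv ℝ j g (AffineMap.homothety c t x) := by
  have e : ∀ y, AffineMap.homothety c t y = t • y + (c - t • c) := by
    intro y
    rw [AffineMap.homothety_apply, vsub_eq_sub, vadd_eq_add, smul_sub]
    abel
  simp only [e]
  have hG : ContDiff ℝ j (fun z => g (z + (c - t • c))) :=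
    (hg.of_le (by exact_mod_cast le_top)).comp (contDiff_id.add contDiff_const)
  have := congrFun (iteratedFDeriv_comp_const_smul t hG) x
  simp only [iteratedFDeriv_comp_add_right] at this
  exact this

/-- Norms of derivatives of polynomials on a larger set are controlled by those on a smaller one. -/
lemma pap_poly_extend (d N : ℕ) : ∃ L : ℝ, 0 ≤ L ∧ ∀ (K Q : Set (Euc d)) (c : Euc d),
    (∀ t : ℝ, 0 < t → t ≤ 1 / 3 → MapsTo (AffineMap.homothety c t) K Q) →
    ∀ g : Euc d → ℝ, MemPoly d N g → ∀ (j : ℕ) (p : ℝ≥0∞), 1 ≤ p →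
      eLpNorm (fun x => ‖iteratedFDeriv ℝ j g x‖) p (volume.restrict K) ≤
        ENNReal.ofReal L * eLpNorm (fun x => ‖iteratedFDeriv ℝ j g x‖) p (volume.restrict Q) := by
  set θ : Fin (N + 1) → ℝ := fun m => 1 / (3 * ((m : ℕ) + 1)) with hθ
  have hθ0 : ∀ m, 0 < θ m := fun m => by rw [hθ]; positivity
  have hθ3 : ∀ m, θ m ≤ 1 / 3 := fun m => by
    rw [hθ]
    refine one_div_le_one_div_of_le (by norm_num) ?_
    have : (0 : ℝ) ≤ (m : ℕ) := Nat.cast_nonneg _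
    linarith
  have hθi : Function.Injective θ := by
    intro a b h
    simp only [hθ, one_div, inv_inj] at h
    have h' : ((a : ℕ) : ℝ) = (b : ℕ) := by linarith
    exact Fin.ext (by exact_mod_cast h')
  set lam : Fin (N + 1) → ℝ := fun m => (Lagrange.basis Finset.univ θ m).eval 1 with hlam
  refine ⟨∑ m, |lam m| * (θ m)⁻¹ ^ d, Finset.sum_nonneg fun m _ => by
    have := hθ0 m
    positivity, ?_⟩
  intro K Q c hmap g hg j p hp
  have hgc := pap_memPoly_contDiff hg
  have hDc : Continuous (iteratedFDeriv ℝ j g) := hgc.continuous_iteratedFDeriv (by exact_mod_cast le_top)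
  have hhc : ∀ m, Continuous (AffineMap.homothety c (θ m) : Euc d →ᵃ[ℝ] Euc d) := fun m =>
    AffineMap.homothety_continuous c (θ m)
  have hge : g = fun x => ∑ m, (fun y => lam m • g (AffineMap.homothety c (θ m) y)) x := by
    funext x
    exact pap_extrapolate hg θ hθi c x
  have hcd : ∀ m, ContDiff ℝ (⊤ : ℕ∞) (fun y => g (AffineMap.homothety c (θ m) y)) := by
    intro m
    refine hgc.comp ?_
    have e : ∀ y, AffineMap.homothety c (θ m) y = θ m • (y - c) + c := fun y => by
      rw [AffineMap.homothety_apply, vsub_eq_sub, vadd_eq_add]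
    rw [funext e]
    fun_prop
  have hD : ∀ x, iteratedFDeriv ℝ j g x =
      ∑ m, (lam m * θ m ^ j) • iteratedFDeriv ℝ j g (AffineMap.homothety c (θ m) x) := by
    intro x
    conv_lhs => rw [hge]
    rw [iteratedFDeriv_fun_sum_apply]
    · refine Finset.sum_congr rfl fun m _ => ?_
      have := iteratedFDeriv_const_smul_apply (𝕜 := ℝ) (i := j) (x := x) (a := lam m)
        (f := fun y => g (AffineMap.homothety c (θ m) y))
        ((hcd m).of_le (by exact_mod_cast le_top)).contDiffAt
      refine Eq.trans this ?_
      rw [pap_iter_homothety hgc, smul_smul]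
    · intro m _
      have hm : ContDiff ℝ j (fun y => g (AffineMap.homothety c (θ m) y)) :=
        (hcd m).of_le (by exact_mod_cast le_top)
      exact (hm.const_smul (lam m)).contDiffAt
  have hle : ∀ x, ‖iteratedFDeriv ℝ j g x‖ ≤
      (∑ m, fun x => |lam m| • ‖iteratedFDeriv ℝ j g (AffineMap.homothety c (θ m) x)‖) x := by
    intro x
    rw [Finset.sum_apply]
    conv_lhs => rw [hD x]
    refine (norm_sum_le _ _).trans (Finset.sum_le_sum fun m _ => ?_)
    rw [norm_smul, Real.norm_eq_abs, abs_mul, smul_eq_mul]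
    refine mul_le_mul_of_nonneg_right ?_ (norm_nonneg _)
    refine mul_le_of_le_one_right (abs_nonneg _) ?_
    rw [abs_of_pos (pow_pos (hθ0 m) j)]
    exact pow_le_one₀ (hθ0 m).le ((hθ3 m).trans (by norm_num))
  calc eLpNorm (fun x => ‖iteratedFDeriv ℝ j g x‖) p (volume.restrict K)
      ≤ eLpNorm (∑ m, fun x => |lam m| • ‖iteratedFDeriv ℝ j g (AffineMap.homothety c (θ m) x)‖) p
          (volume.restrict K) := by
        refine eLpNorm_mono fun x => ?_
        rw [norm_norm]
        exact (hle x).trans (le_abs_self _)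
    _ ≤ ∑ m, eLpNorm (fun x => |lam m| • ‖iteratedFDeriv ℝ j g (AffineMap.homothety c (θ m) x)‖) p
          (volume.restrict K) := by
        refine eLpNorm_sum_le (fun m _ => ?_) hp
        have hm : Continuous fun x =>
            |lam m| • ‖iteratedFDeriv ℝ j g (AffineMap.homothety c (θ m) x)‖ :=
          ((hDc.comp (hhc m)).norm).const_smul |lam m|
        exact hm.aestronglyMeasurable
    _ ≤ ∑ m, ENNReal.ofReal (|lam m| * (θ m)⁻¹ ^ d) *
          eLpNorm (fun x => ‖iteratedFDeriv ℝ j g x‖) p (volume.restrict Q) := by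
        refine Finset.sum_le_sum fun m _ => ?_
        have h1 := pap_eLpNorm_homothety (hθ0 m) ((hθ3 m).trans (by norm_num))
          (hmap _ (hθ0 m) (hθ3 m)) (g := fun x => ‖iteratedFDeriv ℝ j g x‖)
          hDc.norm.stronglyMeasurable hp
        have h2 := eLpNorm_const_smul_le (c := |lam m|)
          (f := fun x => ‖iteratedFDeriv ℝ j g (AffineMap.homothety c (θ m) x)‖) (p := p)
          (μ := volume.restrict K)
        refine h2.trans ?_
        rw [ENNReal.ofReal_mul (abs_nonneg _), mul_assoc, ← Real.enorm_eq_ofReal (abs_nonneg _)]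
        exact mul_le_mul_right h1 _
    _ = _ := by
        rw [← Finset.sum_mul, ENNReal.ofReal_sum_of_nonneg]
        intro m _
        have := hθ0 m
        positivity

lemma pap_cube_compact {d : ℕ} (c : Euc d) (r : ℝ) : IsCompact (cube d c r) := by
  have : cube d c r = (WithLp.toLp 2) '' (Set.pi univ fun i => Icc (c i - r) (c i + r)) := by
    ext x
    constructor
    · intro hx
      refine ⟨WithLp.ofLp x, fun i _ => ?_, rfl⟩
      have := abs_le.1 (hx i)
      exact ⟨by linarith, by linarith⟩
    · rintro ⟨y, hy, rfl⟩ i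
      have := hy i (mem_univ i)
      exact abs_le.2 ⟨by linarith [this.1], by linarith [this.2]⟩
  rw [this]
  exact (isCompact_univ_pi fun i => isCompact_Icc).image (PiLp.continuous_toLp 2 _)

lemma pap_cube_volume {d : ℕ} (c : Euc d) {r : ℝ} (hr : 0 < r) : volume (cube d c r) ≠ 0 := by
  have h : ball c r ⊆ cube d c r := by
    intro x hx i
    have h1 := PiLp.norm_apply_le (x - c) i
    have h2 : ‖x - c‖ < r := by rwa [← dist_eq_norm]
    exact h1.trans h2.le
  exact ((measure_ball_pos volume c hr).trans_le (measure_mono h)).ne'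

lemma pap_union_eq {d : ℕ} {c c' : Euc d} {r : ℝ} (hr : 0 < r)
    (h : c' = c ∨ ∃ i : Fin d, (∀ j, j ≠ i → c' j = c j) ∧ |c' i - c i| = 2 * r) :
    cube d c r ∪ cube d c' r =
      {x : Euc d | ∀ j, min (c j) (c' j) - r ≤ x j ∧ x j ≤ max (c j) (c' j) + r} := by
  ext x
  rcases h with rfl | ⟨i, hi, hir⟩
  · simp only [union_self, cube, mem_setOf_eq, min_self, max_self, abs_le]
    refine forall_congr' fun j => ?_
    constructor <;> rintro ⟨h1, h2⟩ <;> constructor <;> linarith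
  · simp only [cube, mem_union, mem_setOf_eq]
    constructor
    · rintro (h | h) j
      · have := abs_le.1 (h j)
        exact ⟨by linarith [min_le_left (c j) (c' j)], by linarith [le_max_left (c j) (c' j)]⟩
      · have := abs_le.1 (h j)
        exact ⟨by linarith [min_le_right (c j) (c' j)], by linarith [le_max_right (c j) (c' j)]⟩
    · intro h
      have hi' : |x i - c i| ≤ r ∨ |x i - c' i| ≤ r := by
        obtain ⟨h1, h2⟩ := h i
        rcases le_total (c i) (c' i) with hc | hc
        · rw [min_eq_left hc] at h1
          rw [max_eq_right hc] at h2
          rw [abs_of_nonneg (by linarith)] at hir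
          rcases le_total (x i) (c i + r) with hx | hx
          · left; exact abs_le.2 ⟨by linarith, by linarith⟩
          · right; exact abs_le.2 ⟨by linarith, by linarith⟩
        · rw [min_eq_right hc] at h1
          rw [max_eq_left hc] at h2
          rw [abs_of_nonpos (by linarith)] at hir
          rcases le_total (x i) (c' i + r) with hx | hx
          · right; exact abs_le.2 ⟨by linarith, by linarith⟩
          · left; exact abs_le.2 ⟨by linarith, by linarith⟩
      refine hi'.imp (fun hh j => ?_) (fun hh j => ?_)
      all_goals
        by_cases hj : j = i
        · rw [hj]; exact hh
        · have := h j
          rw [hi j hj, min_self, max_self] at this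
          try rw [hi j hj]
          exact abs_le.2 ⟨by linarith [this.1], by linarith [this.2]⟩

lemma pap_box_convex {d : ℕ} (a b : Fin d → ℝ) :
    Convex ℝ {x : Euc d | ∀ j, a j ≤ x j ∧ x j ≤ b j} := by
  intro x hx y hy s t hs ht hst j
  have h := (convex_Icc (a j) (b j)) (hx j) (hy j) hs ht hst
  exact h

lemma pap_union_mapsTo {d : ℕ} {c c' : Euc d} {r : ℝ} (hr : 0 < r)
    (h : c' = c ∨ ∃ i : Fin d, (∀ j, j ≠ i → c' j = c j) ∧ |c' i - c i| = 2 * r)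
    (t : ℝ) (ht : 0 < t) (ht3 : t ≤ 1 / 3) :
    MapsTo (AffineMap.homothety c t) (cube d c r ∪ cube d c' r) (cube d c r) := by
  have hcc : ∀ j, |c' j - c j| ≤ 2 * r := by
    intro j
    rcases h with rfl | ⟨i, hi, hir⟩
    · simp; positivity
    · by_cases hj : j = i
      · rw [hj, hir]
      · rw [hi j hj]; simp; positivity
  intro x hx j
  have h3 : |x j - c j| ≤ 3 * r := by
    rcases hx with hx | hx
    · linarith [hx j]
    · have h1 := abs_sub_le (x j) (c' j) (c j)
      linarith [hx j, hcc j]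
  have e : (AffineMap.homothety c t x) j - c j = t * (x j - c j) := by
    simp [AffineMap.homothety_apply]
  rw [e, abs_mul, abs_of_pos ht]
  calc t * |x j - c j| ≤ 1 / 3 * (3 * r) := by gcongr
    _ = r := by ring

lemma pap_union_dist {d : ℕ} {c : Euc d} {r : ℝ} {K : Set (Euc d)}
    (h : MapsTo (AffineMap.homothety c (1 / 3 : ℝ)) K (cube d c r)) :
    ∀ x ∈ K, ∀ y ∈ K, dist x y ≤ 3 * Metric.diam (cube d c r) := by
  intro x hx y hy
  have h1 := Metric.dist_le_diam_of_mem (pap_cube_compact c r).isBounded (h hx) (h hy)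
  have e : dist (AffineMap.homothety c (1 / 3 : ℝ) x) (AffineMap.homothety c (1 / 3 : ℝ) y) =
      1 / 3 * dist x y := by
    rw [AffineMap.homothety_apply, AffineMap.homothety_apply, dist_vadd_cancel_right, dist_smul₀,
      dist_vsub_cancel_right]
    norm_num
  rw [e] at h1
  linarith

/-- Poincaré-type estimate for an adapted polynomial projection: if `Q` and `R` are touching
cubes of the same side length (or `Q = R`) and `P` is a linear projection onto polynomials of
degree at most `k - 1` which is `L^{p'}(Q)`-stable on all derivatives up to order `k` with
constant `C₀`, then for every `f` smooth on a neighbourhood of `Q ∪ R`, all `0 ≤ ℓ ≤ k`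
and all orders `j ≤ ℓ` of differentiation,
`‖∇^j (f − Pf)‖_{L^p(Q ∪ R)} ≤ C diam(Q)^{ℓ−j} ‖∇^ℓ f‖_{L^p(Q ∪ R)}`,
where `C` depends only on `d`, `k`, `p` (and the stability constant `C₀`). -/
theorem poincare_adapted_polynomial (d k : ℕ) (hd : 0 < d) (p : ℝ≥0∞) (hp : 1 ≤ p)
    (C₀ : ℝ) (hC₀ : 0 < C₀) :
    ∃ C : ℝ, 0 < C ∧
      ∀ (c c' : Euc d) (r : ℝ), 0 < r →
        (c' = c ∨ ∃ i : Fin d, (∀ j, j ≠ i → c' j = c j) ∧ |c' i - c i| = 2 * r) →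
        ∀ U : Set (Euc d), IsOpen U → cube d c r ∪ cube d c' r ⊆ U →
        ∀ P : (Euc d → ℝ) → (Euc d → ℝ),
          IsLinearMap ℝ P →
          (∀ f, MemPoly d (k - 1) (P f)) →
          (∀ q, MemPoly d (k - 1) q → P q = q) →
          (∀ f : Euc d → ℝ, ContDiffOn ℝ (⊤ : ℕ∞) f U → ∀ p' : ℝ≥0∞, 1 ≤ p' → ∀ j, j ≤ k →
            eLpNorm (fun x => ‖iteratedFDeriv ℝ j (P f) x‖) p'
                (volume.restrict (cube d c r)) ≤
              ENNReal.ofReal C₀ * eLpNorm (fun x => ‖iteratedFDerivWithin ℝ j f U x‖) p'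
                (volume.restrict (cube d c r))) →
          ∀ f : Euc d → ℝ, ContDiffOn ℝ (⊤ : ℕ∞) f U → ∀ ℓ, ℓ ≤ k → ∀ j, j ≤ ℓ →
            eLpNorm (fun x => ‖iteratedFDerivWithin ℝ j (fun y => f y - P f y) U x‖) p
                (volume.restrict (cube d c r ∪ cube d c' r)) ≤
              ENNReal.ofReal (C * Metric.diam (cube d c r) ^ (ℓ - j)) *
                eLpNorm (fun x => ‖iteratedFDerivWithin ℝ ℓ f U x‖) p
                  (volume.restrict (cube d c r ∪ cube d c' r)) := by
  obtain ⟨L, hL0, hL⟩ := pap_poly_extend d (k - 1)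
  refine ⟨(1 + L * C₀) * (3 * 2 ^ d) ^ k, by positivity, ?_⟩
  intro c c' r hr htouch U hU hKU P hPlin hPpoly hPproj hPstab f hf l hl j hj
  set K := cube d c r ∪ cube d c' r with hKdef
  have hQK : cube d c r ⊆ K := subset_union_left
  have hKc : IsCompact K := (pap_cube_compact c r).union (pap_cube_compact c' r)
  have hKm : MeasurableSet K := hKc.measurableSet
  have hQm : MeasurableSet (cube d c r) := (pap_cube_compact c r).measurableSet
  have hKconv : Convex ℝ K := by
    rw [hKdef, pap_union_eq hr htouch]
    exact pap_box_convex _ _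
  have hK0 : volume K ≠ 0 := fun h =>
    pap_cube_volume c hr (measure_mono_null hQK h)
  have hmaps := pap_union_mapsTo hr htouch
  have hdist := pap_union_dist (hmaps (1 / 3) (by norm_num) le_rfl)
  set δ := Metric.diam (cube d c r) with hδ
  have hδ0 : 0 ≤ δ := Metric.diam_nonneg
  -- the polynomial adapted to the averages on `K`
  obtain ⟨q, hqP, hqz, hqm⟩ := pap_exists_poly hKc hK0 hU hKU l f hf
  have hqc := pap_memPoly_contDiff hqP
  have hqk : MemPoly d (k - 1) q := pap_memPoly_mono (by omega) hqP
  set g : Euc d → ℝ := f - q with hgdef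
  have hg : ContDiffOn ℝ (⊤ : ℕ∞) g U := hf.sub hqc.contDiffOn
  have hPg : P g = P f - q := by rw [hgdef, hPlin.map_sub, hPproj q hqk]
  have hPgc : ContDiff ℝ (⊤ : ℕ∞) (P g) := pap_memPoly_contDiff (hPpoly g)
  have hfun : (fun y => f y - P f y) = g - P g := by
    funext y
    rw [hPg, hgdef]
    simp
  have hwithin : ∀ (n : ℕ) (u : Euc d → ℝ) (x : Euc d), x ∈ U →
      iteratedFDerivWithin ℝ n u U x = iteratedFDeriv ℝ n u x := fun n u x hx =>
    iteratedFDerivWithin_of_isOpen n hU hx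
  have hcongr : ∀ (n : ℕ) (u : Euc d → ℝ) (S : Set (Euc d)), MeasurableSet S → S ⊆ K →
      eLpNorm (fun x => ‖iteratedFDerivWithin ℝ n u U x‖) p (volume.restrict S) =
        eLpNorm (fun x => ‖iteratedFDeriv ℝ n u x‖) p (volume.restrict S) := by
    intro n u S hS hSK
    refine eLpNorm_congr_ae ?_
    filter_upwards [ae_restrict_mem hS] with x hx
    rw [hwithin n u x (hKU (hSK hx))]
  -- the estimate for `g`
  have hA := pap_poincare_iter hKconv hKc hK0 hU hKU (by positivity) hdist hg hqm hp (l - j) j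
    (by omega)
  -- the estimate for `P g`
  have hB : eLpNorm (fun x => ‖iteratedFDeriv ℝ j (P g) x‖) p (volume.restrict K) ≤
      ENNReal.ofReal (L * C₀) *
        eLpNorm (fun x => ‖iteratedFDeriv ℝ j g x‖) p (volume.restrict K) := by
    have h1 := hL K (cube d c r) c hmaps (P g) (hPpoly g) j p hp
    have h2 := hPstab g hg p hp j (hj.trans hl)
    rw [hcongr j g _ hQm hQK] at h2
    have h3 : eLpNorm (fun x => ‖iteratedFDeriv ℝ j g x‖) p (volume.restrict (cube d c r)) ≤
        eLpNorm (fun x => ‖iteratedFDeriv ℝ j g x‖) p (volume.restrict K) :=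
      eLpNorm_mono_measure _ (Measure.restrict_mono hQK le_rfl)
    rw [ENNReal.ofReal_mul hL0, mul_assoc]
    exact h1.trans (mul_le_mul_right (h2.trans (mul_le_mul_right h3 _)) _)
  -- the top order derivatives of `g` and `f` agree
  have hE : eLpNorm (fun x => ‖iteratedFDeriv ℝ l g x‖) p (volume.restrict K) =
      eLpNorm (fun x => ‖iteratedFDeriv ℝ l f x‖) p (volume.restrict K) := by
    refine eLpNorm_congr_ae ?_
    filter_upwards [ae_restrict_mem hKm] with x hx
    have c1 : ContDiffAt ℝ l f x :=
      (hf.contDiffAt (hU.mem_nhds (hKU hx))).of_le (by exact_mod_cast le_top)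
    have c2 : ContDiffAt ℝ l q x := (hqc.of_le (by exact_mod_cast le_top)).contDiffAt
    rw [hgdef, iteratedFDeriv_sub_apply c1 c2, hqz l le_rfl, sub_zero]
  rw [hcongr l f K hKm subset_rfl, hcongr j _ K hKm subset_rfl, hfun]
  have hgm : AEStronglyMeasurable (fun x => ‖iteratedFDeriv ℝ j g x‖) (volume.restrict K) := by
    refine ContinuousOn.aestronglyMeasurable (fun x hx => ?_) hKm
    exact (pap_contDiffAt_iter hU hg 0 j (hKU hx)).continuousAt.norm.continuousWithinAt
  have hPm : AEStronglyMeasurable (fun x => ‖iteratedFDeriv ℝ j (P g) x‖) (volume.restrict K) :=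
    (hPgc.continuous_iteratedFDeriv (by exact_mod_cast le_top)).norm.aestronglyMeasurable
  calc eLpNorm (fun x => ‖iteratedFDeriv ℝ j (g - P g) x‖) p (volume.restrict K)
      ≤ eLpNorm ((fun x => ‖iteratedFDeriv ℝ j g x‖) + fun x => ‖iteratedFDeriv ℝ j (P g) x‖) p
          (volume.restrict K) := by
        refine eLpNorm_mono_ae ?_
        filter_upwards [ae_restrict_mem hKm] with x hx
        have c1 : ContDiffAt ℝ j g x :=
          (hg.contDiffAt (hU.mem_nhds (hKU hx))).of_le (by exact_mod_cast le_top)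
        have c2 : ContDiffAt ℝ j (P g) x := (hPgc.of_le (by exact_mod_cast le_top)).contDiffAt
        rw [iteratedFDeriv_sub_apply c1 c2, norm_norm]
        exact (norm_sub_le _ _).trans (le_abs_self _)
    _ ≤ eLpNorm (fun x => ‖iteratedFDeriv ℝ j g x‖) p (volume.restrict K) +
          eLpNorm (fun x => ‖iteratedFDeriv ℝ j (P g) x‖) p (volume.restrict K) :=
        eLpNorm_add_le hgm hPm hp
    _ ≤ eLpNorm (fun x => ‖iteratedFDeriv ℝ j g x‖) p (volume.restrict K) +
          ENNReal.ofReal (L * C₀) *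
            eLpNorm (fun x => ‖iteratedFDeriv ℝ j g x‖) p (volume.restrict K) := by
        exact add_le_add le_rfl hB
    _ = ENNReal.ofReal (1 + L * C₀) *
          eLpNorm (fun x => ‖iteratedFDeriv ℝ j g x‖) p (volume.restrict K) := by
        rw [ENNReal.ofReal_add zero_le_one (by positivity), ENNReal.ofReal_one, add_mul, one_mul]
    _ ≤ ENNReal.ofReal (1 + L * C₀) * (ENNReal.ofReal ((2 ^ d * (3 * δ)) ^ (l - j)) *
          eLpNorm (fun x => ‖iteratedFDeriv ℝ l f x‖) p (volume.restrict K)) := by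
        rw [hE] at hA
        exact mul_le_mul_right hA _
    _ ≤ _ := by
        rw [← mul_assoc, ← ENNReal.ofReal_mul (by positivity)]
        refine mul_le_mul_left (ENNReal.ofReal_le_ofReal ?_) _
        rw [mul_assoc]
        refine mul_le_mul_of_nonneg_left ?_ (by positivity)
        have e : (2 ^ d * (3 * δ)) ^ (l - j) = (3 * 2 ^ d) ^ (l - j) * δ ^ (l - j) := by
          rw [← mul_pow]; ring
        rw [e]
        refine mul_le_mul_of_nonneg_right ?_ (by positivity)
        have h2 : (1 : ℝ) ≤ 2 ^ d := one_le_pow₀ (by norm_num)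
        exact pow_le_pow_right₀ (by linarith) (by omega)
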